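/- Let n ≥ 1 and k be natural numbers with k ≤ n²/4. Then every finite simple graph G with n vertices and k edges satisfies β(G) ≥ (n + √(n² − 4k))/2, and equality holds if and only if G is triangle-free. In particular, the minimum of β(G) over all graphs with n vertices and k edges equals (n + √(n² − 4k))/2. -/

import Mathlib

noncomputable section

/-- The number of cliques of size `k` in `G` (the empty set is the unique clique of size 0). -/
def cliqueCount {V : Type*} [Fintype V] (G : SimpleGraph V) (k : ℕ) : ℕ :=
  Nat.card {s : Finset V // G.IsNClique k s}

/-- The clique number `ω(G)` of `G`. -/
def cliqueNum {V : Type*} [Fintype V] (G : SimpleGraph V) : ℕ :=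
  sSup {k : ℕ | ∃ s : Finset V, G.IsNClique k s}

/-- The PC-polynomial `PC(G,x) = ∑_{k=0}^{ω(G)} (-1)^k c_k(G) x^{ω(G)-k}`. -/
def PCpoly {V : Type*} [Fintype V] (G : SimpleGraph V) : Polynomial ℝ :=
  ∑ k ∈ Finset.range (cliqueNum G + 1),
    Polynomial.C ((-1 : ℝ) ^ k * (cliqueCount G k : ℝ)) * Polynomial.X ^ (cliqueNum G - k)

/-- `β(G)`, the largest real root of the PC-polynomial of `G`. -/
def beta {V : Type*} [Fintype V] (G : SimpleGraph V) : ℝ :=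
  sSup {x : ℝ | (PCpoly G).eval x = 0}

section CliqueSeries

open Finset Classical

variable {V : Type*} (G : SimpleGraph V)

/-- The cliques of `G` contained in `S`. -/
def cliquesIn (S : Finset V) : Finset (Finset V) :=
  S.powerset.filter fun T => G.IsClique T

/-- The number of `2`-cliques of `G` contained in `S`. -/
def edgeCountIn (S : Finset V) : ℕ :=
  #{T ∈ cliquesIn G S | #T = 2}

/-- The clique generating function `∑ (-t)^|T|` over the cliques `T` of `G` contained in `S`. -/
def cliqueSeries (S : Finset V) (t : ℝ) : ℝ :=
  ∑ T ∈ cliquesIn G S, (-t) ^ #T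

variable {G} in
theorem mem_cliquesIn {S T : Finset V} : T ∈ cliquesIn G S ↔ T ⊆ S ∧ G.IsClique T := by
  simp [cliquesIn]

theorem cliquesIn_empty : cliquesIn G ∅ = {∅} := by
  ext T
  simp only [mem_cliquesIn, subset_empty, mem_singleton, and_iff_left_iff_imp]
  rintro rfl
  simp

theorem sum_cliquesIn_insert {M : Type*} [AddCommMonoid M] (f : Finset V → M) {a : V}
    {S : Finset V} (ha : a ∉ S) :
    ∑ T ∈ cliquesIn G (insert a S), f T =
      ∑ T ∈ cliquesIn G S, f T + ∑ T ∈ cliquesIn G (S.filter (G.Adj a)), f (insert a T) := by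
  rw [cliquesIn, sum_filter, sum_powerset_insert ha, ← sum_filter, ← sum_filter]
  congr 1
  refine sum_congr ?_ fun _ _ => rfl
  ext T
  simp only [mem_cliquesIn, mem_filter, mem_powerset, coe_insert, subset_iff]
  constructor
  · rintro ⟨hT, hc⟩
    have haT : a ∉ T := fun h => ha (hT h)
    rw [SimpleGraph.isClique_insert_of_notMem (by simpa using haT)] at hc
    exact ⟨fun x hx => ⟨hT hx, hc.2 x hx⟩, hc.1⟩
  · rintro ⟨hT, hc⟩
    exact ⟨fun x hx => (hT hx).1, SimpleGraph.isClique_insert.2 ⟨hc, fun b hb _ => (hT hb).2⟩⟩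

theorem notMem_of_mem_cliquesIn_filter {a : V} {S T : Finset V}
    (hT : T ∈ cliquesIn G (S.filter (G.Adj a))) : a ∉ T := fun h =>
  G.loopless.irrefl a (mem_filter.1 ((mem_cliquesIn.1 hT).1 h)).2

@[simp]
theorem cliqueSeries_empty (t : ℝ) : cliqueSeries G ∅ t = 1 := by
  simp [cliqueSeries, cliquesIn_empty]

theorem cliqueSeries_insert {a : V} {S : Finset V} (ha : a ∉ S) (t : ℝ) :
    cliqueSeries G (insert a S) t =
      cliqueSeries G S t - t * cliqueSeries G (S.filter (G.Adj a)) t := by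
  unfold cliqueSeries
  rw [sum_cliquesIn_insert G _ ha, sub_eq_add_neg, ← neg_mul, mul_sum]
  congr 1
  refine sum_congr rfl fun T hT => ?_
  rw [card_insert_of_notMem (notMem_of_mem_cliquesIn_filter G hT), pow_succ']

theorem cliqueSeries_zero (S : Finset V) : cliqueSeries G S 0 = 1 := by
  induction S using Finset.induction_on with
  | empty => simp
  | insert a S ha ih => rw [cliqueSeries_insert G ha, ih]; simp

theorem continuous_cliqueSeries (S : Finset V) : Continuous (cliqueSeries G S) := by
  unfold cliqueSeries
  fun_prop

theorem edgeCountIn_insert {a : V} {S : Finset V} (ha : a ∉ S) :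
    edgeCountIn G (insert a S) = edgeCountIn G S + #(S.filter (G.Adj a)) := by
  rw [edgeCountIn, card_filter, sum_cliquesIn_insert G _ ha, ← card_filter, ← card_filter,
    edgeCountIn]
  congr 1
  rw [← card_map ⟨fun x : V => ({x} : Finset V), singleton_injective⟩]
  congr 1
  ext T
  simp only [mem_filter, mem_map, Function.Embedding.coeFn_mk]
  constructor
  · rintro ⟨hT, h2⟩
    rw [card_insert_of_notMem (notMem_of_mem_cliquesIn_filter G hT)] at h2
    obtain ⟨x, rfl⟩ := card_eq_one.1 (Nat.succ_injective h2)
    exact ⟨x, by simpa using (mem_cliquesIn.1 hT).1, rfl⟩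
  · rintro ⟨x, ⟨hx, hax⟩, rfl⟩
    refine ⟨mem_cliquesIn.2 ⟨by simp [hx, hax], by simp⟩, ?_⟩
    rw [card_insert_of_notMem (by simpa using hax.ne), card_singleton]

section Bounds

variable {G} {t : ℝ}

theorem cliqueSeries_anti (ht : 0 ≤ t) (hD : ∀ T, 0 ≤ cliqueSeries G T t) {S T : Finset V}
    (h : S ⊆ T) : cliqueSeries G T t ≤ cliqueSeries G S t := by
  rw [← union_eq_right.2 h]
  clear h
  induction T using Finset.induction_on with
  | empty => simp
  | insert a T _ ih =>
    rw [union_insert]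
    by_cases ha : a ∈ S ∪ T
    · rwa [insert_eq_of_mem ha]
    · rw [cliqueSeries_insert G ha]
      have := mul_nonneg ht (hD ((S ∪ T).filter (G.Adj a)))
      linarith

theorem cliqueSeries_le_one (ht : 0 ≤ t) (hD : ∀ T, 0 ≤ cliqueSeries G T t) (S : Finset V) :
    cliqueSeries G S t ≤ 1 := by
  simpa using cliqueSeries_anti ht hD (empty_subset S)

theorem one_sub_le_cliqueSeries (ht : 0 ≤ t) (hD : ∀ T, 0 ≤ cliqueSeries G T t) (S : Finset V) :
    1 - #S * t ≤ cliqueSeries G S t := by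
  induction S using Finset.induction_on with
  | empty => simp
  | insert a S ha ih =>
    rw [cliqueSeries_insert G ha, card_insert_of_notMem ha]
    have := mul_le_mul_of_nonneg_left (cliqueSeries_le_one ht hD (S.filter (G.Adj a))) ht
    push_cast
    linarith

theorem cliqueSeries_le_quadratic (ht : 0 ≤ t) (hD : ∀ T, 0 ≤ cliqueSeries G T t) (S : Finset V) :
    cliqueSeries G S t ≤ 1 - #S * t + edgeCountIn G S * t ^ 2 := by
  induction S using Finset.induction_on with
  | empty => simp; positivity
  | insert a S ha ih =>
    rw [cliqueSeries_insert G ha, card_insert_of_notMem ha, edgeCountIn_insert G ha]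
    have := mul_le_mul_of_nonneg_left (one_sub_le_cliqueSeries ht hD (S.filter (G.Adj a))) ht
    push_cast
    linarith

theorem cliqueSeries_lt_one (ht : 0 < t) (hD : ∀ T, 0 ≤ cliqueSeries G T t) {S : Finset V} {a : V}
    (ha : a ∈ S) : cliqueSeries G S t < 1 := by
  have h := cliqueSeries_anti ht.le hD (singleton_subset_iff.2 ha)
  rw [← insert_empty_eq, cliqueSeries_insert G (notMem_empty a)] at h
  simp only [filter_empty, cliqueSeries_empty] at h
  linarith

theorem one_sub_lt_cliqueSeries (ht : 0 < t) (hD : ∀ T, 0 ≤ cliqueSeries G T t) {S : Finset V}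
    {a b : V} (ha : a ∈ S) (hb : b ∈ S) (hab : G.Adj a b) :
    1 - #S * t < cliqueSeries G S t := by
  have hlt : cliqueSeries G ((S.erase a).filter (G.Adj a)) t < 1 :=
    cliqueSeries_lt_one ht hD (a := b) (by simp [hb, hab, hab.ne'])
  have h := one_sub_le_cliqueSeries ht.le hD (S.erase a)
  have := mul_lt_mul_of_pos_left hlt ht
  rw [← insert_erase ha, cliqueSeries_insert G (notMem_erase a S),
    card_insert_of_notMem (notMem_erase a S)]
  push_cast
  linarith

theorem cliqueSeries_lt_quadratic (ht : 0 < t) (hD : ∀ T, 0 ≤ cliqueSeries G T t) {S : Finset V}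
    {a b c : V} (ha : a ∈ S) (hb : b ∈ S) (hc : c ∈ S) (hab : G.Adj a b) (hac : G.Adj a c)
    (hbc : G.Adj b c) :
    cliqueSeries G S t < 1 - #S * t + edgeCountIn G S * t ^ 2 := by
  have hlt := one_sub_lt_cliqueSeries ht hD (S := (S.erase a).filter (G.Adj a))
    (a := b) (b := c) (by simp [hb, hab, hab.ne']) (by simp [hc, hac, hac.ne']) hbc
  have h := cliqueSeries_le_quadratic ht.le hD (S.erase a)
  have := mul_lt_mul_of_pos_left hlt ht
  rw [← insert_erase ha, cliqueSeries_insert G (notMem_erase a S),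
    card_insert_of_notMem (notMem_erase a S), edgeCountIn_insert G (notMem_erase a S)]
  push_cast
  linarith

end Bounds

theorem nonneg_at_of_pos_on_Ico {f : ℝ → ℝ} (hf : Continuous f) {r : ℝ} (hr : 0 < r)
    (h : ∀ t ∈ Set.Ico 0 r, 0 < f t) : 0 ≤ f r :=
  le_on_closure (f := fun _ => (0 : ℝ)) (fun t ht => (h t ht).le) continuousOn_const
    hf.continuousOn (closure_Ico hr.ne ▸ Set.right_mem_Icc.2 hr.le)

variable {G} in
theorem cliqueSeries_pos_of_subset {S : Finset V} {r : ℝ}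
    (hS : ∀ t ∈ Set.Ico 0 r, 0 < cliqueSeries G S t) {T : Finset V} (hT : T ⊆ S) :
    ∀ t ∈ Set.Ico 0 r, 0 < cliqueSeries G T t := by
  induction S using Finset.strongInduction generalizing T r with
  | H S ih =>
  obtain rfl | hTS := eq_or_ssubset_of_subset hT
  · exact hS
  obtain ⟨a, haS, haT⟩ := exists_of_ssubset hTS
  refine ih _ (erase_ssubset haS) ?_ (subset_erase.2 ⟨hT, haT⟩)
  by_contra! hneg
  obtain ⟨u, hu, hu0⟩ := hneg
  obtain ⟨s, ⟨⟨hs, hs0⟩, hmin⟩⟩ :=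
    (isCompact_Icc.inter_right ((isClosed_Iic (a := (0 : ℝ))).preimage
      (continuous_cliqueSeries G (S.erase a)))).exists_isLeast
      ⟨u, Set.right_mem_Icc.2 hu.1, hu0⟩
  rw [Set.mem_preimage, Set.mem_Iic] at hs0
  have hs_pos : 0 < s := by
    refine hs.1.lt_of_ne fun h => ?_
    rw [← h, cliqueSeries_zero] at hs0
    linarith
  have hpos : ∀ t ∈ Set.Ico 0 s, 0 < cliqueSeries G (S.erase a) t := fun t ht => by
    by_contra! h
    exact (hmin ⟨⟨ht.1, ht.2.le.trans hs.2⟩, h⟩).not_gt ht.2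
  have hN := nonneg_at_of_pos_on_Ico (continuous_cliqueSeries G _) hs_pos
    (ih _ (erase_ssubset haS) hpos (filter_subset (G.Adj a) _))
  have h := hS s ⟨hs.1, hs.2.trans_lt hu.2⟩
  rw [← insert_erase haS, cliqueSeries_insert G (notMem_erase a S)] at h
  have := mul_nonneg hs_pos.le hN
  linarith

variable [Fintype V]

variable {G} in
theorem cliqueSeries_nonneg_of_no_root {r : ℝ} (hr : 0 < r)
    (h : ∀ t ∈ Set.Ioo 0 r, cliqueSeries G univ t ≠ 0) (T : Finset V) :
    0 ≤ cliqueSeries G T r := by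
  refine nonneg_at_of_pos_on_Ico (continuous_cliqueSeries G T) hr
    (cliqueSeries_pos_of_subset (S := univ) (fun t ht => ?_) (subset_univ T))
  by_contra! hneg
  obtain ⟨s, hs, hs0⟩ := intermediate_value_Icc' ht.1 (continuous_cliqueSeries G univ).continuousOn
    (show (0 : ℝ) ∈ Set.Icc _ _ from ⟨hneg, by simp [cliqueSeries_zero]⟩)
  have hs_pos : 0 < s := by
    refine hs.1.lt_of_ne fun h => ?_
    rw [← h, cliqueSeries_zero] at hs0
    linarith
  exact h s ⟨hs_pos, hs.2.trans_lt ht.2⟩ hs0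

variable {G} in
theorem exists_root_le {r : ℝ} (hr : 0 < r)
    (hq : 1 - (Fintype.card V : ℝ) * r + edgeCountIn G univ * r ^ 2 = 0) :
    ∃ t ∈ Set.Ioc 0 r, cliqueSeries G univ t = 0 := by
  by_contra! h
  have hD := cliqueSeries_nonneg_of_no_root hr fun t ht => h t ⟨ht.1, ht.2.le⟩
  have hle := cliqueSeries_le_quadratic hr.le hD univ
  rw [card_univ, hq] at hle
  exact h r ⟨hr, le_rfl⟩ (le_antisymm hle (hD univ))

variable {G} in
theorem exists_root_lt {r : ℝ} (hr : 0 < r)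
    (hq : 1 - (Fintype.card V : ℝ) * r + edgeCountIn G univ * r ^ 2 = 0) (hG : ¬G.CliqueFree 3) :
    ∃ t ∈ Set.Ioo 0 r, cliqueSeries G univ t = 0 := by
  by_contra! h
  simp only [SimpleGraph.CliqueFree, not_forall, not_not] at hG
  obtain ⟨T, hT⟩ := hG
  obtain ⟨a, b, c, hab, hac, hbc, -⟩ := SimpleGraph.is3Clique_iff.1 hT
  have hD := cliqueSeries_nonneg_of_no_root hr h
  have hlt := cliqueSeries_lt_quadratic hr hD (mem_univ a) (mem_univ b) (mem_univ c) hab hac hbc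
  rw [card_univ, hq] at hlt
  exact (hD univ).not_gt hlt

theorem cliqueCount_eq_card (k : ℕ) : cliqueCount G k = #{T ∈ cliquesIn G univ | #T = k} := by
  rw [cliqueCount, Nat.card_eq_fintype_card, Fintype.card_subtype]
  congr 1
  ext T
  simp [mem_cliquesIn, SimpleGraph.isNClique_iff]

theorem cliqueCount_zero : cliqueCount G 0 = 1 := by
  change Nat.card (G.cliqueSet 0) = 1
  simp

theorem cliqueCount_one : cliqueCount G 1 = Fintype.card V := by
  change Nat.card (G.cliqueSet 1) = _
  rw [SimpleGraph.cliqueSet_one, Nat.card_range_of_injective singleton_injective,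
    Nat.card_eq_fintype_card]

theorem cliqueCount_two : cliqueCount G 2 = Nat.card G.edgeSet := by
  symm
  refine Nat.card_eq_of_bijective (fun e => ⟨e.1.toFinset, ?_⟩) ⟨?_, ?_⟩
  · obtain ⟨⟨a, b⟩, he⟩ := e
    have hab : G.Adj a b := he
    change G.IsNClique 2 (Sym2.toFinset s(a, b))
    rw [Sym2.toFinset_mk_eq, SimpleGraph.isNClique_iff]
    exact ⟨by simp [SimpleGraph.isClique_iff, hab],
      card_pair hab.ne⟩
  · intro e f h
    refine Subtype.ext (Sym2.ext fun x => ?_)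
    rw [← Sym2.mem_toFinset, ← Sym2.mem_toFinset, Subtype.mk.inj h]
  · rintro ⟨T, hT⟩
    obtain ⟨a, b, hab, rfl⟩ := card_eq_two.1 hT.card_eq
    have hadj : G.Adj a b := hT.isClique (by simp) (by simp) hab
    exact ⟨⟨s(a, b), hadj⟩, Subtype.ext (Sym2.toFinset_mk_eq)⟩

theorem edgeCountIn_univ : edgeCountIn G univ = Nat.card G.edgeSet := by
  rw [← cliqueCount_two, cliqueCount_eq_card, edgeCountIn]

theorem cliqueSeries_eq_sum_range {N : ℕ} (hN : ∀ k, N ≤ k → G.CliqueFree k) (t : ℝ) :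
    cliqueSeries G univ t = ∑ k ∈ range N, (cliqueCount G k : ℝ) * (-t) ^ k := by
  rw [cliqueSeries, ← sum_fiberwise_of_maps_to (g := card) (t := range N)]
  · refine sum_congr rfl fun k _ => ?_
    rw [cliqueCount_eq_card, ← nsmul_eq_mul, ← sum_const]
    exact sum_congr rfl fun T hT => by rw [(mem_filter.1 hT).2]
  · intro T hT
    by_contra hk
    exact hN #T (by simpa using hk) T ⟨(mem_cliquesIn.1 hT).2, rfl⟩

theorem cliqueFree_of_cliqueNum_lt {k : ℕ} (hk : cliqueNum G + 1 ≤ k) : G.CliqueFree k :=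
  fun T hT => by
    have := hT.isClique.card_le_cliqueNum
    rw [hT.card_eq] at this
    exact absurd (this.trans_lt hk) (lt_irrefl _)

theorem eval_PCpoly {x : ℝ} (hx : x ≠ 0) :
    (PCpoly G).eval x = x ^ cliqueNum G * cliqueSeries G univ x⁻¹ := by
  rw [cliqueSeries_eq_sum_range G fun k => cliqueFree_of_cliqueNum_lt G, PCpoly,
    Polynomial.eval_finsetSum, mul_sum]
  refine sum_congr rfl fun k hk => ?_
  have hk : k ≤ cliqueNum G := Nat.lt_succ_iff.1 (mem_range.1 hk)
  rw [Polynomial.eval_mul, Polynomial.eval_C, Polynomial.eval_pow, Polynomial.eval_X,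
    ← mul_inv_cancel_right₀ (pow_ne_zero k hx) (x ^ (cliqueNum G - k)), ← pow_add,
    Nat.sub_add_cancel hk, neg_pow x⁻¹, inv_pow]
  ring

theorem PCpoly_ne_zero : PCpoly G ≠ 0 := fun h => by
  have hc : (PCpoly G).coeff (cliqueNum G) = 1 := by
    rw [PCpoly, Polynomial.finsetSum_coeff, sum_eq_single 0]
    · simp [cliqueCount_zero]
    · intro k hk hk0
      rw [Polynomial.coeff_C_mul_X_pow, if_neg]
      rw [mem_range] at hk
      omega
    · simp
  simp [h] at hc

theorem le_beta_of_root {t : ℝ} (ht : t ≠ 0) (h : cliqueSeries G univ t = 0) : t⁻¹ ≤ beta G := by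
  refine le_csSup (Polynomial.finite_setOfPred_isRoot (PCpoly_ne_zero G)).bddAbove ?_
  simp [eval_PCpoly G (inv_ne_zero ht), h]

variable {G} in
theorem cliqueSeries_of_cliqueFree (hG : G.CliqueFree 3) (t : ℝ) :
    cliqueSeries G univ t = 1 - Fintype.card V * t + edgeCountIn G univ * t ^ 2 := by
  rw [cliqueSeries_eq_sum_range G (N := 3) fun k hk => hG.mono hk]
  simp only [sum_range_succ, range_zero, sum_empty, cliqueCount_zero, cliqueCount_one,
    cliqueCount_two, edgeCountIn_univ]
  push_cast
  ring

variable {G} in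
theorem beta_le_of_cliqueFree {b : ℝ} (hb : 0 < b) (hG : G.CliqueFree 3)
    (hroot : ∀ x : ℝ, x ^ 2 - Fintype.card V * x + Nat.card G.edgeSet = 0 → x ≤ b) :
    beta G ≤ b := by
  refine Real.sSup_le (fun x hx => ?_) hb.le
  obtain rfl | hx0 := eq_or_ne x 0
  · exact hb.le
  have h : cliqueSeries G univ x⁻¹ = 0 := by
    simpa [eval_PCpoly G hx0, hx0] using hx
  rw [cliqueSeries_of_cliqueFree hG, edgeCountIn_univ] at h
  refine hroot x ?_
  field_simp at h
  linarith

end CliqueSeries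

/-- The larger root of `x² - n x + k` is the lower bound for `β`, attained exactly by triangle-free
graphs. -/
theorem beta_bound {V : Type*} [Fintype V] (G : SimpleGraph V) {b : ℝ} (hb : 0 < b)
    (hroot : b ^ 2 - Fintype.card V * b + Nat.card G.edgeSet = 0)
    (hmax : ∀ x : ℝ, x ^ 2 - Fintype.card V * x + Nat.card G.edgeSet = 0 → x ≤ b) :
    b ≤ beta G ∧ (beta G = b ↔ G.CliqueFree 3) := by
  have hq : 1 - (Fintype.card V : ℝ) * b⁻¹ + edgeCountIn G Finset.univ * b⁻¹ ^ 2 = 0 := by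
    rw [edgeCountIn_univ]
    field_simp
    linarith
  have hle : b ≤ beta G := by
    obtain ⟨t, ht, ht0⟩ := exists_root_le (inv_pos.2 hb) hq
    exact ((le_inv_comm₀ hb ht.1).2 ht.2).trans (le_beta_of_root G ht.1.ne' ht0)
  refine ⟨hle, fun h => ?_, fun h => (beta_le_of_cliqueFree hb h hmax).antisymm hle⟩
  by_contra hG
  obtain ⟨t, ht, ht0⟩ := exists_root_lt (inv_pos.2 hb) hq hG
  exact h.not_gt (((lt_inv_comm₀ hb ht.1).2 ht.2).trans_le (le_beta_of_root G ht.1.ne' ht0))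

theorem exists_cliqueFree_three_card_edgeSet (n k : ℕ) (hk : 4 * k ≤ n ^ 2) :
    ∃ G : SimpleGraph (Fin n), G.CliqueFree 3 ∧ Nat.card G.edgeSet = k := by
  classical
  have hcard : k ≤ (SimpleGraph.turanGraph n 2).edgeFinset.card := by
    rw [SimpleGraph.card_edgeFinset_turanGraph]
    obtain ⟨m, rfl | rfl⟩ := n.even_or_odd'
    · simp
      have : (2 * m) ^ 2 = 4 * m ^ 2 := by ring
      omega
    · simp [Nat.add_mod]
      have : (2 * m + 1) ^ 2 = 4 * m ^ 2 + 4 * m + 1 := by ring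
      omega
  obtain ⟨E, hE, rfl⟩ := Finset.exists_subset_card_eq hcard
  have hsub : (E : Set (Sym2 (Fin n))) ⊆ (SimpleGraph.turanGraph n 2).edgeSet := fun e he => by
    simpa using hE he
  refine ⟨SimpleGraph.fromEdgeSet E, ?_, ?_⟩
  · refine (SimpleGraph.turanGraph_cliqueFree (n := n) two_pos).anti ?_
    exact (SimpleGraph.fromEdgeSet_mono hsub).trans_eq (SimpleGraph.fromEdgeSet_edgeSet _)
  · rw [SimpleGraph.edgeSet_fromEdgeSet, sdiff_eq_left.2, Nat.card_coe_set_eq, Set.ncard_coe_finset]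
    exact Set.subset_compl_iff_disjoint_right.1
      (hsub.trans (SimpleGraph.edgeSet_subset_compl_diagSet _))

/-- For `k ≤ n²/4`: every graph with `n` vertices and `k` edges satisfies
`β(G) ≥ (n + √(n² - 4k))/2`, with equality iff `G` is triangle-free; in particular
the minimum of `β` over all such graphs equals `(n + √(n² - 4k))/2`. -/
theorem stmt_14 (n k : ℕ) (hn : 1 ≤ n) (hk : 4 * k ≤ n ^ 2) :
    (∀ {V : Type} [Fintype V] (G : SimpleGraph V), Fintype.card V = n →
      Nat.card G.edgeSet = k →
        (((n : ℝ) + Real.sqrt ((n : ℝ) ^ 2 - 4 * (k : ℝ))) / 2 ≤ beta G ∧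
          (beta G = ((n : ℝ) + Real.sqrt ((n : ℝ) ^ 2 - 4 * (k : ℝ))) / 2 ↔
            G.CliqueFree 3))) ∧
    (∃ G : SimpleGraph (Fin n), Nat.card G.edgeSet = k ∧
      beta G = ((n : ℝ) + Real.sqrt ((n : ℝ) ^ 2 - 4 * (k : ℝ))) / 2) := by
  set b : ℝ := ((n : ℝ) + Real.sqrt ((n : ℝ) ^ 2 - 4 * (k : ℝ))) / 2 with hb_def
  have hnk : (0 : ℝ) ≤ (n : ℝ) ^ 2 - 4 * k := by
    rw [sub_nonneg]
    exact_mod_cast hk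
  have hn_pos : (0 : ℝ) < n := by exact_mod_cast hn
  have hb : 0 < b := by positivity
  have hroot : b ^ 2 - n * b + k = 0 := by
    have := Real.sq_sqrt hnk
    rw [hb_def]
    linarith
  have hmax : ∀ x : ℝ, x ^ 2 - n * x + k = 0 → x ≤ b := fun x hx => by
    have : 2 * x - n ≤ Real.sqrt ((n : ℝ) ^ 2 - 4 * k) :=
      Real.le_sqrt_of_sq_le (by linarith)
    rw [hb_def]
    linarith
  have main : ∀ {V : Type} [Fintype V] (G : SimpleGraph V), Fintype.card V = n →
      Nat.card G.edgeSet = k → b ≤ beta G ∧ (beta G = b ↔ G.CliqueFree 3) := by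
    rintro V _ G rfl rfl
    exact beta_bound G hb hroot hmax
  refine ⟨main, ?_⟩
  obtain ⟨G, hG, hGk⟩ := exists_cliqueFree_three_card_edgeSet n k hk
  exact ⟨G, hGk, (main G (Fintype.card_fin n) hGk).2.2 hG⟩
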